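/- arXiv:2106.13806 — 4 statements merged into one kernel-verified Lean document; each statement's English description precedes it below -/
import Mathlib

section
/- There exists a symmetric matrix U ≻ 0 with U − L^α(U) ≻ 0 if and only if both of the following hold: every complex eigenvalue of A has modulus strictly less than α^{−1/2}, and (the operator I − α𝔸 being then invertible, where 𝔸(U) = AᵀUA) the spectral radius of the composed linear operator (I − α𝔸)⁻¹ ∘ Z_x on symmetric n×n matrices is strictly less than α⁻¹, where Z_x(U) = Diag(σ̄ₓᵀ U σ̄ₓ). -/
open Matrix

noncomputable section

/-- The space of symmetric `n × n` real matrices, as a submodule of the matrix space. -/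
def symSub (n : ℕ) : Submodule ℝ (Matrix (Fin n) (Fin n) ℝ) where
  carrier := {M | M.IsSymm}
  add_mem' hA hB := hA.add hB
  zero_mem' := Matrix.isSymm_zero
  smul_mem' c _ hA := hA.smul c

/-- Congruence `U ↦ Xᵀ U X` as a linear map on matrices. -/
def congrLin {n : ℕ} (X : Matrix (Fin n) (Fin n) ℝ) :
    Matrix (Fin n) (Fin n) ℝ →ₗ[ℝ] Matrix (Fin n) (Fin n) ℝ :=
  LinearMap.mulLeft ℝ Xᵀ ∘ₗ LinearMap.mulRight ℝ X

lemma congrLin_isSymm {n : ℕ} (X : Matrix (Fin n) (Fin n) ℝ)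
    {U : Matrix (Fin n) (Fin n) ℝ} (hU : U.IsSymm) : (congrLin X U).IsSymm := by
  show ((Xᵀ * (U * X))ᵀ) = Xᵀ * (U * X)
  rw [Matrix.transpose_mul, Matrix.transpose_mul, Matrix.transpose_transpose, hU,
    Matrix.mul_assoc]

/-- `Z_x(U) = Diag(σ̄ₓᵀ U σ̄ₓ)` as a linear map on matrices. -/
def ZxLin {n : ℕ} (σbx : Matrix (Fin n) (Fin n) ℝ) :
    Matrix (Fin n) (Fin n) ℝ →ₗ[ℝ] Matrix (Fin n) (Fin n) ℝ :=
  Matrix.diagonalLinearMap (Fin n) ℝ ℝ ∘ₗ Matrix.diagLinearMap (Fin n) ℝ ℝ ∘ₗ congrLin σbx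

/-- `L^α(U) = α (Aᵀ U A + Z_x(U))` as a linear map on matrices. -/
def LalphaLin {n : ℕ} (α : ℝ) (A σbx : Matrix (Fin n) (Fin n) ℝ) :
    Matrix (Fin n) (Fin n) ℝ →ₗ[ℝ] Matrix (Fin n) (Fin n) ℝ :=
  α • (congrLin A + ZxLin σbx)

lemma ZxLin_isSymm {n : ℕ} (σbx : Matrix (Fin n) (Fin n) ℝ)
    (U : Matrix (Fin n) (Fin n) ℝ) : (ZxLin σbx U).IsSymm :=
  Matrix.isSymm_diagonal _

lemma LalphaLin_mem {n : ℕ} (α : ℝ) (A σbx : Matrix (Fin n) (Fin n) ℝ) :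
    ∀ U ∈ symSub n, LalphaLin α A σbx U ∈ symSub n := fun U hU =>
  (((congrLin_isSymm A hU).add (ZxLin_isSymm σbx U)).smul α : Matrix.IsSymm _)

/-- `U ↦ Aᵀ U A` as a linear endomorphism of the space of symmetric matrices. -/
def AEnd {n : ℕ} (A : Matrix (Fin n) (Fin n) ℝ) : Module.End ℝ (symSub n) :=
  (congrLin A).restrict (fun _ hU => congrLin_isSymm A hU)

/-- `Z_x` as a linear endomorphism of the space of symmetric matrices. -/
def ZxEnd {n : ℕ} (σbx : Matrix (Fin n) (Fin n) ℝ) : Module.End ℝ (symSub n) :=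
  (ZxLin σbx).restrict (fun U _ => ZxLin_isSymm σbx U)

/-- `L^α` as a linear endomorphism of the space of symmetric matrices. -/
def LalphaEnd {n : ℕ} (α : ℝ) (A σbx : Matrix (Fin n) (Fin n) ℝ) : Module.End ℝ (symSub n) :=
  (LalphaLin α A σbx).restrict (LalphaLin_mem α A σbx)

/-- The spectral radius of a square real matrix: the maximum modulus of its complex
eigenvalues. -/
def specRadC {k : ℕ} (M : Matrix (Fin k) (Fin k) ℝ) : ℝ :=
  sSup {r : ℝ | ∃ μ ∈ spectrum ℂ (M.map Complex.ofReal), r = ‖μ‖}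

/-- The spectral radius of a linear endomorphism of a finite-dimensional real vector space:
the maximum modulus of the complex eigenvalues of a matrix representation. -/
def specRadEnd {V : Type*} [AddCommGroup V] [Module ℝ V] [FiniteDimensional ℝ V]
    (f : V →ₗ[ℝ] V) : ℝ :=
  specRadC (LinearMap.toMatrix (Module.finBasis ℝ V) (Module.finBasis ℝ V) f)

end

open Filter Topology

section LinftyNorm

attribute [local instance] Matrix.linftyOpNormedRing Matrix.linftyOpNormedAlgebra

lemma tendsto_inv_pow_smul_pow_of_spectrum_lt {k : ℕ} (N : Matrix (Fin k) (Fin k) ℂ)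
    {r : ℝ} (hr : 0 < r) (h : ∀ μ ∈ spectrum ℂ N, ‖μ‖ < r) :
    Tendsto (fun j : ℕ => (r⁻¹ ^ j) • N ^ j) atTop (𝓝 0) := by
  rcases isEmpty_or_nonempty (Fin k) with hk | hk
  · exact tendsto_const_nhds.congr fun _ => Subsingleton.elim _ _
  have hρ : spectralRadius ℂ N < ENNReal.ofReal r :=
    spectrum.spectralRadius_lt_of_forall_lt N fun μ hμ => by
      rw [← NNReal.coe_lt_coe, coe_nnnorm, Real.coe_toNNReal r hr.le]
      exact h μ hμ
  obtain ⟨q, hq, hqr⟩ := ENNReal.lt_iff_exists_nnreal_btwn.1 hρ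
  have hqr' : (q : ℝ) < r := by
    rwa [← ENNReal.ofReal_coe_nnreal, ENNReal.ofReal_lt_ofReal_iff hr] at hqr
  have hlim := (spectrum.pow_nnnorm_pow_one_div_tendsto_nhds_spectralRadius N).eventually_lt_const hq
  have hgeom : Tendsto (fun j : ℕ => (r⁻¹ * q) ^ j) atTop (𝓝 0) := by
    refine tendsto_pow_atTop_nhds_zero_of_lt_one (by positivity) ?_
    rwa [inv_mul_lt_iff₀ hr, mul_one]
  refine squeeze_zero_norm' ?_ hgeom
  filter_upwards [hlim, eventually_gt_atTop 0] with j hj hj0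
  have hj1 : (‖N ^ j‖₊ : ENNReal) ≤ (q : ENNReal) ^ j := by
    have := ENNReal.rpow_le_rpow hj.le (Nat.cast_nonneg j : (0 : ℝ) ≤ j)
    rwa [← ENNReal.rpow_mul, one_div, inv_mul_cancel₀ (by positivity), ENNReal.rpow_one,
      ENNReal.rpow_natCast] at this
  have hj2 : ‖N ^ j‖ ≤ (q : ℝ) ^ j := by exact_mod_cast hj1
  rw [norm_smul, mul_pow, Real.norm_of_nonneg (by positivity)]
  gcongr

end LinftyNorm

lemma spectrum_map_ofReal_norm_lt_iff_tendsto_pow {k : ℕ} (M : Matrix (Fin k) (Fin k) ℝ)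
    {r : ℝ} (hr : 0 < r) :
    (∀ μ ∈ spectrum ℂ (M.map Complex.ofReal), ‖μ‖ < r) ↔
      Tendsto (fun j : ℕ => (r⁻¹ • M) ^ j) atTop (𝓝 0) := by
  have hmap : ∀ j : ℕ, ((r⁻¹ • M) ^ j).map Complex.ofReal =
      (r⁻¹ ^ j) • (M.map Complex.ofReal) ^ j := fun j => by
    have hpow : (M ^ j).map Complex.ofReal = (M.map Complex.ofReal) ^ j :=
      map_pow (Complex.ofRealHom.mapMatrix (m := Fin k)) M j
    rw [smul_pow, ← hpow]
    ext a b
    simp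
  refine ⟨fun h => ?_, fun h μ hμ => ?_⟩
  · have hc := tendsto_inv_pow_smul_pow_of_spectrum_lt _ hr h
    have hre := ((continuous_id.matrix_map Complex.continuous_re).tendsto
      (0 : Matrix (Fin k) (Fin k) ℂ)).comp hc
    have h0 : (0 : Matrix (Fin k) (Fin k) ℂ).map Complex.re = 0 := by ext; simp
    simp only [id, h0] at hre
    refine hre.congr fun j => ?_
    rw [Function.comp_apply, ← hmap j]
    ext a b
    simp
  · rw [← Matrix.spectrum_toLin', ← Module.End.hasEigenvalue_iff_mem_spectrum] at hμ
    obtain ⟨v, hv⟩ := hμ.exists_hasEigenvector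
    obtain ⟨i, hi⟩ := Function.ne_iff.1 hv.2
    have hpow : ∀ j : ℕ, (((r⁻¹ • M) ^ j).map Complex.ofReal *ᵥ v) i = (r⁻¹ * μ) ^ j * v i :=
      fun j => by
        have := congrFun (hv.pow_apply j) i
        rw [← Matrix.toLin'_pow, Matrix.toLin'_apply] at this
        rw [hmap, Matrix.smul_mulVec, Pi.smul_apply, this]
        simp [mul_pow, mul_assoc]
    have hlim : Tendsto (fun j : ℕ => (((r⁻¹ • M) ^ j).map Complex.ofReal *ᵥ v) i) atTop
        (𝓝 0) := by
      have hcont : Continuous fun B : Matrix (Fin k) (Fin k) ℝ =>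
          (B.map Complex.ofReal *ᵥ v) i :=
        (continuous_apply i).comp
          ((continuous_id.matrix_map Complex.continuous_ofReal).matrix_mulVec continuous_const)
      have := (hcont.tendsto 0).comp h
      have h0 : (0 : Matrix (Fin k) (Fin k) ℝ).map Complex.ofReal = 0 := by ext; simp
      simpa [h0, Function.comp_def] using this
    simp only [hpow] at hlim
    have hlim' : Tendsto (fun j : ℕ => (r⁻¹ * μ) ^ j) atTop (𝓝 0) := by
      have := hlim.mul_const (v i)⁻¹
      simpa [mul_assoc, mul_inv_cancel₀ hi] using this
    have := tendsto_pow_atTop_nhds_zero_iff_norm_lt_one.1 hlim'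
    rw [norm_mul, Complex.norm_real, norm_inv, Real.norm_of_nonneg hr.le,
      inv_mul_lt_iff₀ hr, mul_one] at this
    exact this

lemma specRadC_lt_iff {k : ℕ} (M : Matrix (Fin k) (Fin k) ℝ) {r : ℝ} (hr : 0 < r) :
    specRadC M < r ↔ ∀ μ ∈ spectrum ℂ (M.map Complex.ofReal), ‖μ‖ < r := by
  have himage : {s : ℝ | ∃ μ ∈ spectrum ℂ (M.map Complex.ofReal), s = ‖μ‖} =
      norm '' spectrum ℂ (M.map Complex.ofReal) := by
    ext s
    simp [eq_comm]
  rw [specRadC, himage]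
  rcases (spectrum ℂ (M.map Complex.ofReal)).eq_empty_or_nonempty with h | h
  · simp [h, hr]
  · rw [((Set.toFinite _).image _).csSup_lt_iff (h.image _), Set.forall_mem_image]

lemma specRadEnd_lt_iff_tendsto_pow {V : Type*} [AddCommGroup V] [Module ℝ V]
    [FiniteDimensional ℝ V] [TopologicalSpace V] [IsTopologicalAddGroup V]
    [ContinuousSMul ℝ V] [T2Space V] (f : Module.End ℝ V) {r : ℝ} (hr : 0 < r) :
    specRadEnd f < r ↔ ∀ v, Tendsto (fun j : ℕ => ((r⁻¹ • f) ^ j) v) atTop (𝓝 0) := by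
  rw [specRadEnd, specRadC_lt_iff _ hr, spectrum_map_ofReal_norm_lt_iff_tendsto_pow _ hr]
  set b := Module.finBasis ℝ V
  have hpow : ∀ j : ℕ, (r⁻¹ • LinearMap.toMatrix b b f) ^ j =
      LinearMap.toMatrix b b ((r⁻¹ • f) ^ j) := fun j => by
    rw [← map_smul, LinearMap.toMatrix_pow]
  simp only [hpow]
  refine ⟨fun h v => ?_, fun h => ?_⟩
  · have hcont : Continuous (LinearMap.applyₗ v ∘ₗ (Matrix.toLin b b).toLinearMap :
        Matrix _ _ ℝ →ₗ[ℝ] V) := LinearMap.continuous_of_finiteDimensional _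
    simpa [Function.comp_def] using (hcont.tendsto 0).comp h
  · refine tendsto_pi_nhds.2 fun a => tendsto_pi_nhds.2 fun c => ?_
    have hcont : Continuous (b.coord a) := LinearMap.continuous_of_finiteDimensional _
    simpa [Function.comp_def, LinearMap.toMatrix_apply] using (hcont.tendsto 0).comp (h (b c))

open scoped MatrixOrder in
lemma Matrix.PosDef.exists_smul_sub_posSemidef {n : ℕ} {P W : Matrix (Fin n) (Fin n) ℝ}
    (hP : P.PosDef) (hW : W.IsSymm) : ∃ c : ℝ, 0 < c ∧ (c • P - W).PosSemidef := by
  rcases isEmpty_or_nonempty (Fin n) with hn | hn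
  · exact ⟨1, one_pos, by
      rw [Subsingleton.elim (_ - _) (0 : Matrix (Fin n) (Fin n) ℝ)]
      exact .zero⟩
  have hWs : IsSelfAdjoint W := hW
  obtain ⟨ε, hε, hεP⟩ := (CFC.exists_pos_algebraMap_le_iff hP.isHermitian.isSelfAdjoint).2
    fun x hx => hP.isStrictlyPositive.spectrum_pos hx
  obtain ⟨R, hR⟩ := (Set.toFinite (spectrum ℝ W)).bddAbove
  have hWR : W ≤ algebraMap ℝ _ (max R 1) :=
    le_algebraMap_of_spectrum_le (fun x hx => (hR hx).trans (le_max_left _ _)) hWs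
  have hR0 : 0 < max R 1 := lt_max_of_lt_right one_pos
  refine ⟨max R 1 / ε, by positivity, ?_⟩
  have hsum := ((Matrix.le_iff.1 hεP).smul (show 0 ≤ max R 1 / ε by positivity)).add
    (Matrix.le_iff.1 hWR)
  have heq : (max R 1 / ε) • (P - algebraMap ℝ _ ε) + (algebraMap ℝ _ (max R 1) - W) =
      (max R 1 / ε) • P - W := by
    simp [Algebra.algebraMap_eq_smul_one, smul_sub, smul_smul, div_mul_cancel₀ _ hε.ne']
  rwa [heq] at hsum

/-- Symmetric matrices squeezed between `-s j • U` and `s j • U` tend to zero with `s`. -/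
lemma tendsto_zero_of_posSemidef_smul_sub {n : ℕ} {U : Matrix (Fin n) (Fin n) ℝ} {s : ℕ → ℝ}
    (hs : Tendsto s atTop (𝓝 0)) {X : ℕ → symSub n}
    (hsub : ∀ j, (s j • U - X j).PosSemidef) (hadd : ∀ j, (s j • U + X j).PosSemidef) :
    Tendsto X atTop (𝓝 0) := by
  have hquad : ∀ x : Fin n → ℝ,
      Tendsto (fun j => x ⬝ᵥ ((X j : Matrix (Fin n) (Fin n) ℝ) *ᵥ x)) atTop (𝓝 0) := fun x => by
    refine squeeze_zero_norm (a := fun j => s j * (x ⬝ᵥ (U *ᵥ x))) (fun j => ?_) (by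
      simpa using hs.mul_const (x ⬝ᵥ (U *ᵥ x)))
    have h1 := (hsub j).dotProduct_mulVec_nonneg x
    have h2 := (hadd j).dotProduct_mulVec_nonneg x
    simp only [star_trivial, sub_mulVec, add_mulVec, smul_mulVec, dotProduct_sub, dotProduct_add,
      dotProduct_smul, smul_eq_mul] at h1 h2
    rw [Real.norm_eq_abs, abs_le]
    constructor <;> linarith
  rw [tendsto_subtype_rng]
  refine tendsto_pi_nhds.2 fun a => tendsto_pi_nhds.2 fun b => ?_
  have hpol := (((hquad (Pi.single a 1 + Pi.single b 1)).sub (hquad (Pi.single a 1))).sub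
    (hquad (Pi.single b 1))).div_const 2
  simp only [sub_zero, zero_div] at hpol
  refine hpol.congr fun j => ?_
  have hsymm : (X j : Matrix (Fin n) (Fin n) ℝ) b a = (X j : Matrix (Fin n) (Fin n) ℝ) a b :=
    (show (X j : Matrix (Fin n) (Fin n) ℝ).IsSymm from (X j).2).apply a b
  simp [mulVec_add, add_dotProduct, dotProduct_add, hsymm]
  ring

section PositiveEndomorphism

variable {n : ℕ} {T : Module.End ℝ (symSub n)}

lemma pow_apply_posSemidef
    (hT : ∀ W : symSub n, W.1.PosSemidef → (T W).1.PosSemidef) (j : ℕ) :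
    ∀ W : symSub n, W.1.PosSemidef → ((T ^ j) W).1.PosSemidef := by
  induction j with
  | zero => exact fun W hW => hW
  | succ j ih =>
      intro W hW
      rw [pow_succ, Module.End.mul_apply]
      exact ih _ (hT W hW)

lemma tendsto_pow_apply_of_posDef_sub
    (hT : ∀ W : symSub n, W.1.PosSemidef → (T W).1.PosSemidef) {U : symSub n}
    (hU : U.1.PosDef) (hUT : (U - T U).1.PosDef) (W : symSub n) :
    Tendsto (fun j : ℕ => (T ^ j) W) atTop (𝓝 0) := by
  obtain ⟨c, hc, hcU⟩ := hUT.exists_smul_sub_posSemidef U.2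
  obtain ⟨d, hd, hdW⟩ := hU.exists_smul_sub_posSemidef W.2
  obtain ⟨e, he, heW⟩ := hU.exists_smul_sub_posSemidef (-W).2
  set θ := c / (c + 1) with hθ
  have hθ0 : 0 ≤ θ := by positivity
  have hθ1 : θ < 1 := by rw [hθ, div_lt_one (by positivity)]; linarith
  have hstep : (θ • U - T U).1.PosSemidef := by
    have h := (hcU.add hUT.posSemidef).smul (show 0 ≤ (c + 1)⁻¹ by positivity)
    convert h using 1
    simp only [hθ, Submodule.coe_sub, Submodule.coe_smul]
    ext a b
    simp
    field_simp
    ring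
  have hpow : ∀ j : ℕ, (θ ^ j • U - (T ^ j) U).1.PosSemidef := fun j => by
    induction j with
    | zero => simpa using PosSemidef.zero
    | succ j ih =>
      have h := (hT _ ih).add (hstep.smul (pow_nonneg hθ0 j))
      convert h using 1
      rw [← Submodule.coe_smul, ← Submodule.coe_add, map_sub, map_smul, smul_sub, smul_smul,
        ← pow_succ, pow_succ' T, Module.End.mul_apply]
      congr 1
      abel
  have hbound : ∀ V : symSub n, ((d + e) • U - V).1.PosSemidef → ∀ j : ℕ,
      (((d + e) * θ ^ j) • U - (T ^ j) V).1.PosSemidef := fun V hV j => by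
    have h := (pow_apply_posSemidef hT j _ hV).add
      ((hpow j).smul (show 0 ≤ d + e by positivity))
    convert h using 1
    rw [← Submodule.coe_smul, ← Submodule.coe_add, map_sub, map_smul, smul_sub, smul_smul]
    congr 1
    abel
  have hW : ((d + e) • U - W).1.PosSemidef := by
    convert hdW.add (hU.posSemidef.smul he.le) using 1
    simp [add_smul]
    abel
  have hW' : ((d + e) • U - -W).1.PosSemidef := by
    convert heW.add (hU.posSemidef.smul hd.le) using 1
    simp [add_smul]
    abel
  refine tendsto_zero_of_posSemidef_smul_sub (U := U) (s := fun j => (d + e) * θ ^ j) ?_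
    (hbound W hW) fun j => ?_
  · simpa using (tendsto_pow_atTop_nhds_zero_of_lt_one hθ0 hθ1).const_mul (d + e)
  · simpa using hbound (-W) hW' j

lemma posSemidef_of_posSemidef_sub_apply
    (hT : ∀ W : symSub n, W.1.PosSemidef → (T W).1.PosSemidef)
    (hlim : ∀ W, Tendsto (fun j : ℕ => (T ^ j) W) atTop (𝓝 0)) {W : symSub n}
    (hW : (W - T W).1.PosSemidef) : W.1.PosSemidef := by
  have hpartial : ∀ j : ℕ, (W - (T ^ j) W).1.PosSemidef := fun j => by
    induction j with
    | zero => simpa using PosSemidef.zero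
    | succ j ih =>
      have h := ih.add (pow_apply_posSemidef hT j _ hW)
      convert h using 1
      rw [← Submodule.coe_add, map_sub, pow_succ, Module.End.mul_apply]
      congr 1
      abel
  refine PosSemidef.of_dotProduct_mulVec_nonneg W.2 fun x => ?_
  have hcont : Continuous fun V : symSub n => star x ⬝ᵥ (V.1 *ᵥ x) :=
    continuous_const.dotProduct (continuous_subtype_val.matrix_mulVec continuous_const)
  have hWlim : Tendsto (fun j : ℕ => W - (T ^ j) W) atTop (𝓝 W) := by
    simpa using (hlim W).const_sub W
  exact ge_of_tendsto' ((hcont.tendsto W).comp hWlim)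
    fun j => (hpartial j).dotProduct_mulVec_nonneg x

lemma isUnit_one_sub_of_tendsto_pow_apply
    (hlim : ∀ W, Tendsto (fun j : ℕ => (T ^ j) W) atTop (𝓝 0)) : IsUnit (1 - T) := by
  rw [LinearMap.isUnit_iff_ker_eq_bot, LinearMap.ker_eq_bot']
  intro W hW
  have hfix : T W = W := (sub_eq_zero.1 hW).symm
  have hpow : ∀ j : ℕ, (T ^ j) W = W := fun j => by
    induction j with
    | zero => rfl
    | succ j ih => rw [pow_succ, Module.End.mul_apply, hfix, ih]
  have := hlim W
  simp only [hpow] at this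
  exact tendsto_nhds_unique tendsto_const_nhds this

end PositiveEndomorphism

lemma AEnd_apply_posSemidef {n : ℕ} (A : Matrix (Fin n) (Fin n) ℝ) (W : symSub n)
    (hW : W.1.PosSemidef) : (AEnd A W).1.PosSemidef := by
  have h := hW.conjTranspose_mul_mul_same A
  rwa [Matrix.mul_assoc, conjTranspose_eq_transpose_of_trivial] at h

lemma ZxEnd_apply_posSemidef {n : ℕ} (σbx : Matrix (Fin n) (Fin n) ℝ) (W : symSub n)
    (hW : W.1.PosSemidef) : (ZxEnd σbx W).1.PosSemidef :=
  PosSemidef.diagonal fun _ => (AEnd_apply_posSemidef σbx W hW).diag_nonneg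

lemma coe_smul_AEnd_pow_apply {n : ℕ} {α : ℝ} (hα : 0 ≤ α) (A : Matrix (Fin n) (Fin n) ℝ)
    (j : ℕ) (W : symSub n) :
    (((α • AEnd A) ^ j) W).1 = ((√α • A) ^ j)ᵀ * (W.1 * (√α • A) ^ j) := by
  induction j generalizing W with
  | zero => simp
  | succ j ih =>
    have hone : ((α • AEnd A) W).1 = (√α • A)ᵀ * (W.1 * (√α • A)) := by
      rw [transpose_smul, Matrix.mul_smul, Matrix.mul_smul, Matrix.smul_mul, smul_smul,
        Real.mul_self_sqrt hα]
      rfl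
    rw [pow_succ, Module.End.mul_apply, ih, hone, pow_succ', transpose_mul]
    simp only [Matrix.mul_assoc]

lemma spectrum_norm_lt_iff_tendsto_smul_AEnd_pow {n : ℕ} {α : ℝ} (hα : 0 < α)
    (A : Matrix (Fin n) (Fin n) ℝ) :
    (∀ μ ∈ spectrum ℂ (A.map Complex.ofReal), ‖μ‖ < (√α)⁻¹) ↔
      ∀ W, Tendsto (fun j : ℕ => ((α • AEnd A) ^ j) W) atTop (𝓝 0) := by
  rw [spectrum_map_ofReal_norm_lt_iff_tendsto_pow A (by positivity), inv_inv]
  refine ⟨fun h W => ?_, fun h => ?_⟩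
  · rw [tendsto_subtype_rng]
    simp only [coe_smul_AEnd_pow_apply hα.le]
    have hcont : Continuous fun B : Matrix (Fin n) (Fin n) ℝ => Bᵀ * (W.1 * B) :=
      continuous_id.matrix_transpose.matrix_mul (continuous_const.matrix_mul continuous_id)
    simpa [Function.comp_def] using (hcont.tendsto 0).comp h
  · refine tendsto_pi_nhds.2 fun a => tendsto_pi_nhds.2 fun b => ?_
    have hone := h ⟨1, isSymm_one⟩
    rw [tendsto_subtype_rng] at hone
    simp only [coe_smul_AEnd_pow_apply hα.le, Matrix.one_mul] at hone
    have hdiag := tendsto_pi_nhds.1 (tendsto_pi_nhds.1 hone b) b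
    have hsqrt := hdiag.sqrt
    simp only [ZeroMemClass.coe_zero, Matrix.zero_apply, Real.sqrt_zero] at hsqrt
    refine squeeze_zero_norm (fun j => ?_) hsqrt
    rw [Real.norm_eq_abs]
    refine Real.abs_le_sqrt ?_
    rw [Matrix.mul_apply, sq]
    exact Finset.single_le_sum
      (f := fun i => ((√α • A) ^ j)ᵀ b i * ((√α • A) ^ j) i b)
      (fun i _ => mul_self_nonneg (((√α • A) ^ j) i b)) (Finset.mem_univ a)

lemma smul_AEnd_apply_posSemidef {n : ℕ} {α : ℝ} (hα : 0 ≤ α) (A : Matrix (Fin n) (Fin n) ℝ)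
    (W : symSub n) (hW : W.1.PosSemidef) : ((α • AEnd A) W).1.PosSemidef :=
  (AEnd_apply_posSemidef A W hW).smul hα

lemma coe_sub_smul_AEnd_sub_smul_ZxEnd {n : ℕ} (α : ℝ) (A σbx : Matrix (Fin n) (Fin n) ℝ)
    (U : symSub n) :
    (U - (α • AEnd A) U - (α • ZxEnd σbx) U).1 = U.1 - LalphaLin α A σbx U.1 := by
  rw [sub_sub, LalphaLin, smul_add]
  rfl

section Resolvent

variable {n : ℕ} {T g : Module.End ℝ (symSub n)}

lemma resolvent_apply_posSemidef
    (hT : ∀ W : symSub n, W.1.PosSemidef → (T W).1.PosSemidef)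
    (hlim : ∀ W, Tendsto (fun j : ℕ => (T ^ j) W) atTop (𝓝 0)) (hg : (1 - T) * g = 1)
    {W : symSub n} (hW : W.1.PosSemidef) : (g W).1.PosSemidef := by
  have hgW : g W - T (g W) = W := LinearMap.congr_fun hg W
  exact posSemidef_of_posSemidef_sub_apply hT hlim (by rwa [hgW])

lemma resolvent_apply_posDef
    (hT : ∀ W : symSub n, W.1.PosSemidef → (T W).1.PosSemidef)
    (hlim : ∀ W, Tendsto (fun j : ℕ => (T ^ j) W) atTop (𝓝 0)) (hg : (1 - T) * g = 1)
    {W : symSub n} (hW : W.1.PosDef) : (g W).1.PosDef := by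
  have hgW : g W = W + T (g W) := sub_eq_iff_eq_add.1 (LinearMap.congr_fun hg W)
  rw [hgW]
  exact hW.add_posSemidef (hT _ (resolvent_apply_posSemidef hT hlim hg hW.posSemidef))

end Resolvent

/-- There is a symmetric `U ≻ 0` with `U − L^α(U) ≻ 0` iff every complex
eigenvalue of `A` has modulus `< α^{-1/2}` and, `g` denoting the inverse of the operator
`I − α𝔸` (where `𝔸(U) = AᵀUA`) on symmetric matrices, the spectral radius of `g ∘ Z_x`
is `< α⁻¹`. -/
theorem stmt5 (n : ℕ) (α : ℝ) (hα : 0 < α) (A σbx : Matrix (Fin n) (Fin n) ℝ) :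
    (∃ U : Matrix (Fin n) (Fin n) ℝ, U.IsSymm ∧ U.PosDef ∧
        (U - LalphaLin α A σbx U).PosDef) ↔
      ((∀ μ ∈ spectrum ℂ (A.map Complex.ofReal), ‖μ‖ < (Real.sqrt α)⁻¹) ∧
        ∃ g : Module.End ℝ (symSub n),
          g * (1 - α • AEnd A) = 1 ∧ (1 - α • AEnd A) * g = 1 ∧
          specRadEnd (g * ZxEnd σbx) < α⁻¹) := by
  have hAE := smul_AEnd_apply_posSemidef hα.le A
  rw [spectrum_norm_lt_iff_tendsto_smul_AEnd_pow hα]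
  have hpos : ∀ g : Module.End ℝ (symSub n),
      (∀ W, Tendsto (fun j : ℕ => ((α • AEnd A) ^ j) W) atTop (𝓝 0)) →
      (1 - α • AEnd A) * g = 1 → ∀ W : symSub n, W.1.PosSemidef →
      ((α • (g * ZxEnd σbx)) W).1.PosSemidef := fun g hlim hg W hW =>
    (resolvent_apply_posSemidef hAE hlim hg (ZxEnd_apply_posSemidef σbx W hW)).smul hα.le
  constructor
  · rintro ⟨U₀, hsymm, hU, hP⟩
    obtain ⟨U, rfl⟩ : ∃ U : symSub n, U.1 = U₀ := ⟨⟨U₀, hsymm⟩, rfl⟩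
    rw [← coe_sub_smul_AEnd_sub_smul_ZxEnd] at hP
    have hZ : ((α • ZxEnd σbx) U).1.PosSemidef :=
      (ZxEnd_apply_posSemidef σbx U hU.posSemidef).smul hα.le
    have hlim := tendsto_pow_apply_of_posDef_sub hAE hU (by
      simpa using hP.add_posSemidef hZ)
    obtain ⟨u, hu⟩ := isUnit_one_sub_of_tendsto_pow_apply hlim
    have hg : (1 - α • AEnd A) * (u⁻¹).1 = 1 := by rw [← hu, Units.mul_inv]
    have hg' : (u⁻¹).1 * (1 - α • AEnd A) = 1 := by rw [← hu, Units.inv_mul]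
    refine ⟨hlim, (u⁻¹).1, hg', hg, ?_⟩
    rw [specRadEnd_lt_iff_tendsto_pow _ (inv_pos.2 hα), inv_inv]
    refine tendsto_pow_apply_of_posDef_sub (hpos _ hlim hg) hU ?_
    have hgP := resolvent_apply_posDef hAE hlim hg hP
    have hgU : (u⁻¹).1 (U - (α • AEnd A) U) = U := LinearMap.congr_fun hg' U
    rw [map_sub, hgU, LinearMap.smul_apply, map_smul] at hgP
    exact hgP
  · rintro ⟨hlim, g, hg', hg, hrad⟩
    rw [specRadEnd_lt_iff_tendsto_pow _ (inv_pos.2 hα), inv_inv] at hrad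
    obtain ⟨u, hu⟩ := isUnit_one_sub_of_tendsto_pow_apply hrad
    have hh : (1 - α • (g * ZxEnd σbx)) * (u⁻¹).1 = 1 := by rw [← hu, Units.mul_inv]
    set I : symSub n := ⟨1, isSymm_one⟩
    have hgI := resolvent_apply_posDef hAE hlim hg (W := I) PosDef.one
    set U := (u⁻¹).1 (g I)
    have hU : U.1.PosDef := resolvent_apply_posDef (hpos g hlim hg) hrad hh hgI
    refine ⟨U.1, U.2, hU, ?_⟩
    rw [← coe_sub_smul_AEnd_sub_smul_ZxEnd]
    have hUeq : U - α • g (ZxEnd σbx U) = g I := LinearMap.congr_fun hh (g I)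
    have hcancel : ∀ W, (1 - α • AEnd A) (g W) = W := LinearMap.congr_fun hg
    have hfinal := congrArg (1 - α • AEnd A : Module.End ℝ (symSub n)) hUeq
    rw [map_sub, map_smul, hcancel, hcancel] at hfinal
    have hI : U - (α • AEnd A) U - (α • ZxEnd σbx) U = I := hfinal
    rw [hI]
    exact PosDef.one
end

section
/- If there exists a symmetric matrix U₀ ≻ 0 with U₀ − L^α(U₀) ≻ 0, then the operator I − L^α is a bijection of the space of symmetric n×n real matrices, and its inverse maps the positive semidefinite cone into itself: for every symmetric V ⪰ 0, the unique symmetric solution U of U − L^α(U) = V satisfies U ⪰ 0. -/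
open Matrix

/-- A positive definite matrix stays positive semidefinite under small symmetric perturbations. -/
lemma Matrix.PosDef.exists_pos_posSemidef_add_smul {n : ℕ} {P S : Matrix (Fin n) (Fin n) ℝ}
    (hP : P.PosDef) (hS : S.IsSymm) : ∃ ε : ℝ, 0 < ε ∧ (P + ε • S).PosSemidef := by
  have hpos : ∀ x : Fin n → ℝ, x ≠ 0 → 0 < x ⬝ᵥ P *ᵥ x := fun x hx => by
    simpa using hP.dotProduct_mulVec_pos hx
  have hcont : ContinuousOn (fun x : Fin n → ℝ => (x ⬝ᵥ S *ᵥ x) / (x ⬝ᵥ P *ᵥ x))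
      (Metric.sphere 0 1) := by
    refine ContinuousOn.div (Continuous.continuousOn (by fun_prop))
      (Continuous.continuousOn (by fun_prop)) fun x hx => (hpos x ?_).ne'
    exact ne_zero_of_mem_unit_sphere ⟨x, hx⟩
  obtain ⟨C, hC⟩ := (isCompact_sphere (0 : Fin n → ℝ) 1).exists_bound_of_continuousOn hcont
  have hC1 : 0 < |C| + 1 := by positivity
  refine ⟨(|C| + 1)⁻¹, inv_pos.2 hC1, .of_dotProduct_mulVec_nonneg ?_ fun x => ?_⟩
  · exact hP.isHermitian.add ((conjTranspose_eq_transpose_of_trivial _).trans (hS.smul _))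
  rcases eq_or_ne x 0 with rfl | hx
  · simp
  have hx0 : ‖x‖ ≠ 0 := norm_ne_zero_iff.2 hx
  have hratio := hC (‖x‖⁻¹ • x) (by simp [norm_smul, hx0])
  simp only [mulVec_smul, smul_dotProduct, dotProduct_smul, smul_eq_mul] at hratio
  rw [mul_div_mul_left _ _ (inv_ne_zero hx0), mul_div_mul_left _ _ (inv_ne_zero hx0),
    Real.norm_eq_abs, abs_div, abs_of_pos (hpos x hx), div_le_iff₀ (hpos x hx)] at hratio
  have hbound : -(x ⬝ᵥ S *ᵥ x) ≤ (|C| + 1) * (x ⬝ᵥ P *ᵥ x) := by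
    nlinarith [neg_abs_le (x ⬝ᵥ S *ᵥ x), le_abs_self C, hpos x hx]
  have hscaled := mul_le_mul_of_nonneg_left hbound (inv_pos.2 hC1).le
  rw [inv_mul_cancel_left₀ hC1.ne'] at hscaled
  simp only [star_trivial, add_mulVec, smul_mulVec, dotProduct_add, dotProduct_smul, smul_eq_mul]
  linarith

lemma isClosed_setOf_posSemidef_add_smul {n : ℕ} {U P : Matrix (Fin n) (Fin n) ℝ}
    (hU : U.IsHermitian) (hP : P.IsHermitian) :
    IsClosed {t : ℝ | (U + t • P).PosSemidef} := by
  have heq : {t : ℝ | (U + t • P).PosSemidef} =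
      ⋂ x : Fin n → ℝ, {t : ℝ | 0 ≤ x ⬝ᵥ U *ᵥ x + t * (x ⬝ᵥ P *ᵥ x)} := by
    ext t
    have hherm : (U + t • P).IsHermitian := hU.add (hP.smul (IsSelfAdjoint.all t))
    simp only [Set.mem_ofPred_eq, posSemidef_iff_dotProduct_mulVec, hherm, true_and, Set.mem_iInter,
      star_trivial, add_mulVec, smul_mulVec, dotProduct_add, dotProduct_smul, smul_eq_mul]
  rw [heq]
  exact isClosed_iInter fun x => isClosed_le (by fun_prop) (by fun_prop)

lemma congrLin_posSemidef {n : ℕ} (X : Matrix (Fin n) (Fin n) ℝ) {U : Matrix (Fin n) (Fin n) ℝ}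
    (hU : U.PosSemidef) : (congrLin X U).PosSemidef := by
  simpa [congrLin, Matrix.mul_assoc] using hU.conjTranspose_mul_mul_same X

lemma LalphaLin_posSemidef {n : ℕ} {α : ℝ} (hα : 0 ≤ α) (A σbx : Matrix (Fin n) (Fin n) ℝ)
    {U : Matrix (Fin n) (Fin n) ℝ} (hU : U.PosSemidef) : (LalphaLin α A σbx U).PosSemidef :=
  ((congrLin_posSemidef A hU).add
    (.diagonal fun _ => (congrLin_posSemidef σbx hU).diag_nonneg)).smul hα

/-- A positive linear map `L` with `U₀ - L U₀ ≻ 0` for some `U₀ ≻ 0` satisfies the minimum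
principle: `U - L U ⪰ 0` implies `U ⪰ 0`. -/
lemma posSemidef_of_sub_posSemidef {n : ℕ}
    {L : Matrix (Fin n) (Fin n) ℝ →ₗ[ℝ] Matrix (Fin n) (Fin n) ℝ}
    (hL : ∀ U : Matrix (Fin n) (Fin n) ℝ, U.PosSemidef → (L U).PosSemidef)
    {U₀ U : Matrix (Fin n) (Fin n) ℝ} (hU₀ : U₀.PosDef) (hLU₀ : (U₀ - L U₀).PosDef)
    (hU : U.IsSymm) (hLU : (U - L U).PosSemidef) : U.PosSemidef := by
  have hUh : U.IsHermitian := (conjTranspose_eq_transpose_of_trivial _).trans hU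
  have hU₀s : U₀.IsSymm := (conjTranspose_eq_transpose_of_trivial _).symm.trans hU₀.isHermitian
  set T : Set ℝ := Set.Ici 0 ∩ {t : ℝ | (U + t • U₀).PosSemidef}
  have hTclosed : IsClosed T :=
    isClosed_Ici.inter (isClosed_setOf_posSemidef_add_smul hUh hU₀.isHermitian)
  have hTne : T.Nonempty := by
    obtain ⟨ε, hε, hpsd⟩ := hU₀.exists_pos_posSemidef_add_smul hU
    refine ⟨ε⁻¹, (inv_pos.2 hε).le, ?_⟩
    have hscaled := hpsd.smul (inv_pos.2 hε).le
    rwa [smul_add, inv_smul_smul₀ hε.ne', add_comm] at hscaled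
  have hTbdd : BddBelow T := ⟨0, fun _ ht => ht.1⟩
  obtain ⟨ht0, htpsd⟩ := hTclosed.csInf_mem hTne hTbdd
  set t := sInf T
  rcases (show (0 : ℝ) ≤ t from ht0).eq_or_lt with h0 | htpos
  · simpa [← h0] using htpsd
  exfalso
  have hpd : (U + t • U₀).PosDef := by
    have hsum := ((hLU₀.smul htpos).add_posSemidef hLU).add_posSemidef (hL _ htpsd)
    convert hsum using 1
    rw [map_add, map_smul, smul_sub]
    abel
  obtain ⟨ε, hε, hpsd⟩ := hpd.exists_pos_posSemidef_add_smul (S := -U₀) hU₀s.neg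
  have hmem : max 0 (t - ε) ∈ T := by
    refine ⟨Set.mem_Ici.2 (le_max_left _ _), ?_⟩
    have hle : 0 ≤ max 0 (t - ε) - (t - ε) := sub_nonneg.2 (le_max_right _ _)
    have hsum := hpsd.add (hU₀.posSemidef.smul hle)
    rw [Set.mem_ofPred_eq]
    convert hsum using 1
    module
  exact (max_lt htpos (sub_lt_self t hε)).not_ge (csInf_le hTbdd hmem)

/-- If there is a symmetric `U₀ ≻ 0` with `U₀ − L^α(U₀) ≻ 0`, then `I − L^α`
is a bijection of the space of symmetric matrices and its inverse maps the PSD cone into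
itself: every symmetric solution `U` of `U − L^α(U) = V` with `V ⪰ 0` satisfies `U ⪰ 0`. -/
theorem stmt6 (n : ℕ) (α : ℝ) (hα : 0 < α) (A σbx : Matrix (Fin n) (Fin n) ℝ)
    (h : ∃ U₀ : Matrix (Fin n) (Fin n) ℝ, U₀.IsSymm ∧ U₀.PosDef ∧
        (U₀ - LalphaLin α A σbx U₀).PosDef) :
    Function.Bijective (1 - LalphaEnd α A σbx : Module.End ℝ (symSub n)) ∧
    ∀ V : Matrix (Fin n) (Fin n) ℝ, V.IsSymm → V.PosSemidef →
      ∀ U : Matrix (Fin n) (Fin n) ℝ, U.IsSymm → U - LalphaLin α A σbx U = V →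
        U.PosSemidef := by
  obtain ⟨U₀, -, hU₀, hLU₀⟩ := h
  have hmin : ∀ U : Matrix (Fin n) (Fin n) ℝ, U.IsSymm →
      (U - LalphaLin α A σbx U).PosSemidef → U.PosSemidef := fun U hU hLU =>
    posSemidef_of_sub_posSemidef (fun _ => LalphaLin_posSemidef hα.le A σbx) hU₀ hLU₀ hU hLU
  refine ⟨?_, fun V _ hV U hU hUV => hmin U hU (hUV ▸ hV)⟩
  have hinj : Function.Injective (1 - LalphaEnd α A σbx : Module.End ℝ (symSub n)) := by
    refine (injective_iff_map_eq_zero _).2 fun ⟨U, hU⟩ hker => ?_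
    have hzero : U - LalphaLin α A σbx U = 0 := congrArg Subtype.val hker
    have hpos : U.PosSemidef := hmin U hU (hzero ▸ .zero)
    have hneg : (-U).PosSemidef := by
      refine hmin (-U) (Matrix.IsSymm.neg hU) ?_
      rw [map_neg, ← neg_sub', hzero, neg_zero]
      exact .zero
    refine Subtype.ext ?_
    open scoped MatrixOrder in
    exact le_antisymm (neg_nonneg.1 hneg.nonneg) hpos.nonneg
  exact ⟨hinj, LinearMap.injective_iff_surjective.1 hinj⟩
end

section
/- Let C ∈ ℝ^{p×n}. Suppose there exist H ∈ ℝ^{n×p} and a symmetric matrix U₀ ≻ 0 such that U₀ − α((A+HC)ᵀ U₀ (A+HC) + Diag(σ̄ₓᵀ U₀ σ̄ₓ)) ≻ 0 (α-detectability of (C, L^α)), and suppose there exists a symmetric matrix L ⪰ 0 satisfying the Lyapunov-type equation L = L^α(L) + CᵀC. Then there exists a symmetric matrix U ≻ 0 with U − L^α(U) ≻ 0 (equivalently, the spectral radius of L^α is strictly less than 1). -/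
open Matrix

noncomputable section

/-- `Z_x(U) = Diag(σ̄ₓᵀ U σ̄ₓ)`. -/
def Zx {n : ℕ} (σbx U : Matrix (Fin n) (Fin n) ℝ) : Matrix (Fin n) (Fin n) ℝ :=
  Matrix.diagonal (fun i => (σbxᵀ * U * σbx) i i)

/-- `Z_u(U) = Diag(σ̄ᵤᵀ U σ̄ᵤ)`. -/
def Zu {n m : ℕ} (σbu : Matrix (Fin n) (Fin m) ℝ) (U : Matrix (Fin n) (Fin n) ℝ) :
    Matrix (Fin m) (Fin m) ℝ :=
  Matrix.diagonal (fun i => (σbuᵀ * U * σbu) i i)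

/-- `L^α(U) = α (Aᵀ U A + Z_x(U))`. -/
def Lop {n : ℕ} (α : ℝ) (A σbx U : Matrix (Fin n) (Fin n) ℝ) : Matrix (Fin n) (Fin n) ℝ :=
  α • (Aᵀ * U * A + Zx σbx U)

/-- `Σ(U) = Bᵀ U A + α⁻¹ Dᵀ C`. -/
def Sig {n m p : ℕ} (α : ℝ) (A : Matrix (Fin n) (Fin n) ℝ) (B : Matrix (Fin n) (Fin m) ℝ)
    (C : Matrix (Fin p) (Fin n) ℝ) (D : Matrix (Fin p) (Fin m) ℝ)
    (U : Matrix (Fin n) (Fin n) ℝ) : Matrix (Fin m) (Fin n) ℝ :=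
  Bᵀ * U * A + α⁻¹ • (Dᵀ * C)

/-- `Λ(U) = Bᵀ U B + Z_u(U) + α⁻¹ Dᵀ D`. -/
def Lam {n m p : ℕ} (α : ℝ) (B σbu : Matrix (Fin n) (Fin m) ℝ) (D : Matrix (Fin p) (Fin m) ℝ)
    (U : Matrix (Fin n) (Fin n) ℝ) : Matrix (Fin m) (Fin m) ℝ :=
  Bᵀ * U * B + Zu σbu U + α⁻¹ • (Dᵀ * D)

/-- `Ric^α(U) = L^α(U) − α Σ(U)ᵀ Λ(U)⁻¹ Σ(U) + Cᵀ C`. -/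
def Ric {n m p : ℕ} (α : ℝ) (A σbx : Matrix (Fin n) (Fin n) ℝ) (B σbu : Matrix (Fin n) (Fin m) ℝ)
    (C : Matrix (Fin p) (Fin n) ℝ) (D : Matrix (Fin p) (Fin m) ℝ)
    (U : Matrix (Fin n) (Fin n) ℝ) : Matrix (Fin n) (Fin n) ℝ :=
  Lop α A σbx U - α • ((Sig α A B C D U)ᵀ * (Lam α B σbu D U)⁻¹ * Sig α A B C D U) + Cᵀ * C

/-- `H^α_G(U) = L^α(U) + Cᵀ C + α (Gᵀ Λ(U) G + Σ(U)ᵀ G + Gᵀ Σ(U))`. -/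
def HG {n m p : ℕ} (α : ℝ) (A σbx : Matrix (Fin n) (Fin n) ℝ) (B σbu : Matrix (Fin n) (Fin m) ℝ)
    (C : Matrix (Fin p) (Fin n) ℝ) (D : Matrix (Fin p) (Fin m) ℝ)
    (G : Matrix (Fin m) (Fin n) ℝ) (U : Matrix (Fin n) (Fin n) ℝ) : Matrix (Fin n) (Fin n) ℝ :=
  Lop α A σbx U + Cᵀ * C +
    α • (Gᵀ * Lam α B σbu D U * G + (Sig α A B C D U)ᵀ * G + Gᵀ * Sig α A B C D U)

end

theorem Matrix.PosDef.exists_pos_sub_smul {ι : Type*} [Fintype ι] {P Q : Matrix ι ι ℝ}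
    (hP : P.PosDef) (hQ : Q.IsHermitian) : ∃ δ : ℝ, 0 < δ ∧ (P - δ • Q).PosDef := by
  rcases isEmpty_or_nonempty ι with hι | hι
  · exact ⟨1, one_pos, .of_dotProduct_mulVec_pos (hP.isHermitian.sub (by simpa using hQ))
      fun x hx => (hx (Subsingleton.elim _ _)).elim⟩
  have hcont (M : Matrix ι ι ℝ) : Continuous fun x : ι → ℝ => x ⬝ᵥ (M *ᵥ x) := by fun_prop
  have hcompact : IsCompact (Metric.sphere (0 : ι → ℝ) 1) := isCompact_sphere _ _
  obtain ⟨y, hy, hmin⟩ := hcompact.exists_isMinOn (NormedSpace.sphere_nonempty.mpr zero_le_one)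
    (hcont P).continuousOn
  obtain ⟨z, -, hmax⟩ := hcompact.exists_isMaxOn (NormedSpace.sphere_nonempty.mpr zero_le_one)
    (hcont Q).continuousOn
  have hm : 0 < y ⬝ᵥ (P *ᵥ y) := hP.dotProduct_mulVec_pos (by rintro rfl; simp at hy)
  set m := y ⬝ᵥ (P *ᵥ y)
  set K := z ⬝ᵥ (Q *ᵥ z)
  have hK : 0 < |K| + 1 := by positivity
  refine ⟨m / (|K| + 1), div_pos hm hK, .of_dotProduct_mulVec_pos
    (hP.isHermitian.sub (by rw [IsHermitian, conjTranspose_smul, hQ.eq, star_trivial]))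
    fun x hx => ?_⟩
  have hxn : 0 < ‖x‖ := norm_pos_iff.mpr hx
  have hu : ‖x‖⁻¹ • x ∈ Metric.sphere (0 : ι → ℝ) 1 := by
    simp [norm_smul, hxn.ne']
  have hlow := hmin hu
  have hupp := hmax hu
  set u := ‖x‖⁻¹ • x
  have hxu : x = ‖x‖ • u := (smul_inv_smul₀ hxn.ne' x).symm
  simp only [Set.mem_ofPred_eq] at hlow hupp
  have hpos : 0 < u ⬝ᵥ (P *ᵥ u) - m / (|K| + 1) * (u ⬝ᵥ (Q *ᵥ u)) := by
    have hlt : m / (|K| + 1) * (u ⬝ᵥ (Q *ᵥ u)) < m / (|K| + 1) * (|K| + 1) :=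
      mul_lt_mul_of_pos_left (by linarith [le_abs_self K]) (div_pos hm hK)
    rw [div_mul_cancel₀ _ hK.ne'] at hlt
    linarith
  rw [hxu]
  simp only [star_trivial, sub_mulVec, smul_mulVec, mulVec_smul, dotProduct_sub, dotProduct_smul,
    smul_dotProduct, smul_eq_mul]
  have := mul_pos (mul_pos hxn hxn) hpos
  linarith

theorem Zx_posSemidef {n : ℕ} (σbx : Matrix (Fin n) (Fin n) ℝ) {U : Matrix (Fin n) (Fin n) ℝ}
    (hU : U.PosSemidef) : (Zx σbx U).PosSemidef :=
  .diagonal fun _ => (hU.conjTranspose_mul_mul_same σbx).diag_nonneg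

theorem Lop_add_smul {n : ℕ} (α c : ℝ) (A σbx U V : Matrix (Fin n) (Fin n) ℝ) :
    Lop α A σbx (U + c • V) = Lop α A σbx U + c • Lop α A σbx V := by
  have hZ : Zx σbx (U + c • V) = Zx σbx U + c • Zx σbx V := by
    simp [Zx, Matrix.mul_add, Matrix.add_mul, ← diagonal_smul, diagonal_add, Pi.smul_def]
  simp only [Lop, hZ, Matrix.mul_add, Matrix.add_mul, Matrix.mul_smul, Matrix.smul_mul]
  module

theorem smul_add_smul_sub_eq_conj {n p : ℕ} {δ : ℝ} (hδ : δ ≠ 0) (A U : Matrix (Fin n) (Fin n) ℝ)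
    (H : Matrix (Fin n) (Fin p) ℝ) (C : Matrix (Fin p) (Fin n) ℝ) :
    (1 + δ) • ((A + H * C)ᵀ * U * (A + H * C)) + (1 + δ⁻¹) • (Cᵀ * (Hᵀ * U * H) * C)
        - Aᵀ * U * A
      = δ⁻¹ • ((δ • (A + H * C) + H * C)ᵀ * U * (δ • (A + H * C) + H * C)) := by
  have hCH : Cᵀ * (Hᵀ * U * H) * C = (H * C)ᵀ * U * (H * C) := by
    simp only [transpose_mul, Matrix.mul_assoc]
  rw [hCH]
  generalize H * C = N
  simp only [transpose_add, transpose_smul, Matrix.mul_add, Matrix.add_mul, Matrix.mul_smul,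
    Matrix.smul_mul, smul_add, smul_smul]
  match_scalars <;> field_simp <;> ring

/-- If `(C, L^α)` is α-detectable (there are `H` and a symmetric `U₀ ≻ 0` with
`U₀ − α((A+HC)ᵀU₀(A+HC) + Diag(σ̄ₓᵀU₀σ̄ₓ)) ≻ 0`) and there is a symmetric `L ⪰ 0` with
`L = L^α(L) + CᵀC`, then there is a symmetric `U ≻ 0` with `U − L^α(U) ≻ 0`. -/
theorem stmt7 {n p : ℕ} (α : ℝ) (hα : 0 < α) (A σbx : Matrix (Fin n) (Fin n) ℝ)
    (C : Matrix (Fin p) (Fin n) ℝ)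
    (hdetect : ∃ H : Matrix (Fin n) (Fin p) ℝ, ∃ U₀ : Matrix (Fin n) (Fin n) ℝ,
      U₀.IsSymm ∧ U₀.PosDef ∧
      (U₀ - α • ((A + H * C)ᵀ * U₀ * (A + H * C) + Zx σbx U₀)).PosDef)
    (hLyap : ∃ L : Matrix (Fin n) (Fin n) ℝ, L.IsSymm ∧ L.PosSemidef ∧
      L = Lop α A σbx L + Cᵀ * C) :
    ∃ U : Matrix (Fin n) (Fin n) ℝ, U.IsSymm ∧ U.PosDef ∧ (U - Lop α A σbx U).PosDef := by
  obtain ⟨H, U₀, hU₀s, hU₀, hdet⟩ := hdetect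
  obtain ⟨L, hLs, hL, hLeq⟩ := hLyap
  have hMUM : ((A + H * C)ᵀ * U₀ * (A + H * C)).PosSemidef :=
    hU₀.posSemidef.conjTranspose_mul_mul_same _
  have hZ : (Zx σbx U₀).PosSemidef := Zx_posSemidef σbx hU₀.posSemidef
  obtain ⟨δ, hδ, hδdef⟩ := hdet.exists_pos_sub_smul ((hMUM.add hZ).smul hα.le).isHermitian
  have hHUH : ((α * (1 + δ⁻¹)) • (Hᵀ * U₀ * H)).PosSemidef :=
    (hU₀.posSemidef.conjTranspose_mul_mul_same H).smul (by positivity)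
  obtain ⟨η, hη, hηdef⟩ :=
    (PosDef.one (n := Fin p) (R := ℝ)).exists_pos_sub_smul hHUH.isHermitian
  refine ⟨U₀ + η⁻¹ • L, hU₀s.add (hLs.smul _),
    hU₀.add_posSemidef (hL.smul (inv_nonneg.mpr hη.le)), ?_⟩
  have hdecomp : U₀ + η⁻¹ • L - Lop α A σbx (U₀ + η⁻¹ • L) =
      (U₀ - α • ((A + H * C)ᵀ * U₀ * (A + H * C) + Zx σbx U₀)
          - δ • α • ((A + H * C)ᵀ * U₀ * (A + H * C) + Zx σbx U₀))
        + (η⁻¹ • (Cᵀ * (1 - η • (α * (1 + δ⁻¹)) • (Hᵀ * U₀ * H)) * C)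
          + ((δ * α) • Zx σbx U₀
            + (α * δ⁻¹) • ((δ • (A + H * C) + H * C)ᵀ * U₀ * (δ • (A + H * C) + H * C)))) := by
    have hLsub : L - Lop α A σbx L = Cᵀ * C := sub_eq_of_eq_add' hLeq
    have hsplit : U₀ + η⁻¹ • L - Lop α A σbx (U₀ + η⁻¹ • L)
        = U₀ - Lop α A σbx U₀ + η⁻¹ • (L - Lop α A σbx L) := by
      rw [Lop_add_smul]; module
    rw [hsplit, hLsub, mul_smul α δ⁻¹, ← smul_add_smul_sub_eq_conj hδ.ne']
    simp only [Lop, Matrix.mul_sub, Matrix.sub_mul, Matrix.mul_one, Matrix.mul_smul,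
      Matrix.smul_mul]
    match_scalars <;> field_simp <;> ring
  rw [hdecomp]
  exact hδdef.add_posSemidef
    (((hηdef.posSemidef.conjTranspose_mul_mul_same C).smul (inv_nonneg.mpr hη.le)).add
      ((hZ.smul (by positivity)).add
        ((hU₀.posSemidef.conjTranspose_mul_mul_same _).smul (by positivity))))
end

section
/- Let α > 0, let Λ ∈ ℝ^{m×m} be symmetric positive definite, B ∈ ℝ^{n×m}, Σ ∈ ℝ^{m×n}, μ ∈ ℝⁿ, x ∈ ℝⁿ, and w ∈ ℝᵐ with wᵢ ≥ 0. For u ∈ ℝᵐ define u⁰(u) = −Λ⁻¹(Σx + ½(Bᵀμ + w ⊙ S(u))) and ρ(u) = (u − u⁰(u))ᵀ Λ (u − u⁰(u)) − (α/4)(Bᵀμ + w ⊙ S(u))ᵀ Λ⁻¹ (Bᵀμ + w ⊙ S(u)). Let M = max over sign vectors s ∈ {−1,0,1}ᵐ of (Bᵀμ + w ⊙ s)ᵀ Λ⁻¹ (Bᵀμ + w ⊙ s). Then −(α/4)·M ≤ inf_{u ∈ ℝᵐ} ρ(u) ≤ (1/4)·M; in particular the infimum is finite. -/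
open Matrix

lemma Matrix.PosSemidef.isSymm_real {ι : Type*} {A : Matrix ι ι ℝ} (hA : A.PosSemidef) : A.IsSymm := by
  simpa [IsHermitian, conjTranspose_eq_transpose_of_trivial, IsSymm] using hA.isHermitian

section QuadraticForm

variable {ι : Type*} [Fintype ι]

lemma dotProduct_mulVec_add_self {A : Matrix ι ι ℝ} (hA : A.IsSymm) (y z : ι → ℝ) :
    (y + z) ⬝ᵥ A *ᵥ (y + z) = y ⬝ᵥ A *ᵥ y + 2 * (z ⬝ᵥ A *ᵥ y) + z ⬝ᵥ A *ᵥ z := by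
  have h : y ⬝ᵥ A *ᵥ z = z ⬝ᵥ A *ᵥ y := by
    rw [dotProduct_mulVec, ← mulVec_transpose, hA.eq, dotProduct_comm]
  simp only [mulVec_add, add_dotProduct, dotProduct_add, h]
  ring

lemma dotProduct_mulVec_smul_self (A : Matrix ι ι ℝ) (t : ℝ) (y : ι → ℝ) :
    (t • y) ⬝ᵥ A *ᵥ (t • y) = t ^ 2 * (y ⬝ᵥ A *ᵥ y) := by
  simp only [mulVec_smul, smul_dotProduct, dotProduct_smul, smul_eq_mul]
  ring

lemma Matrix.PosSemidef.dotProduct_mulVec_self_nonneg {A : Matrix ι ι ℝ} (hA : A.PosSemidef)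
    (y : ι → ℝ) : 0 ≤ y ⬝ᵥ A *ᵥ y := by
  simpa using hA.dotProduct_mulVec_nonneg y

lemma Matrix.PosSemidef.convexOn_dotProduct_mulVec_self {A : Matrix ι ι ℝ} (hA : A.PosSemidef) :
    ConvexOn ℝ Set.univ fun y : ι → ℝ => y ⬝ᵥ A *ᵥ y := by
  refine ⟨convex_univ, fun y _ z _ a b ha hb hab => ?_⟩
  have hyz : a • y + b • z = y + b • (z - y) := by
    obtain rfl : a = 1 - b := by linarith
    module
  have hz := dotProduct_mulVec_add_self hA.isSymm_real y (z - y)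
  rw [add_sub_cancel] at hz
  have h0 := mul_nonneg (mul_nonneg ha hb) (hA.dotProduct_mulVec_self_nonneg (z - y))
  obtain rfl : a = 1 - b := by linarith
  simp only [hyz, smul_eq_mul]
  rw [dotProduct_mulVec_add_self hA.isSymm_real, dotProduct_mulVec_smul_self, smul_dotProduct, hz,
    smul_eq_mul]
  linarith

/-- First-order optimality condition for a minimizer of a quadratic form on a convex set. -/
lemma Matrix.PosSemidef.nonneg_of_isMinOn {A : Matrix ι ι ℝ} (hA : A.PosSemidef)
    {C : Set (ι → ℝ)} (hC : Convex ℝ C) {y z : ι → ℝ} (hy : y ∈ C) (hz : z ∈ C)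
    (hmin : IsMinOn (fun v => v ⬝ᵥ A *ᵥ v) C y) : 0 ≤ (z - y) ⬝ᵥ A *ᵥ y := by
  by_contra! hL
  set L := (z - y) ⬝ᵥ A *ᵥ y with hLdef
  set R := (z - y) ⬝ᵥ A *ᵥ (z - y) with hRdef
  have hR : 0 ≤ R := hA.dotProduct_mulVec_self_nonneg _
  have hD : 0 < R - L := by linarith
  set t := -L / (R - L) with ht
  have ht0 : 0 < t := div_pos (by linarith) hD
  have ht1 : t ≤ 1 := (div_le_one hD).2 (by linarith)
  have htR : t * (R - L) = -L := div_mul_cancel₀ _ hD.ne'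
  have hmem := hC.add_smul_sub_mem hy hz ⟨ht0.le, ht1⟩
  have h := isMinOn_iff.1 hmin _ hmem
  rw [dotProduct_mulVec_add_self hA.isSymm_real, dotProduct_mulVec_smul_self, smul_dotProduct,
    ← hLdef, ← hRdef, smul_eq_mul] at h
  nlinarith [mul_pos ht0 ht0, mul_neg_of_pos_of_neg ht0 hL]

end QuadraticForm

section Box

variable {ι : Type*} [Fintype ι]

lemma Real.sign_mem_Icc (r : ℝ) : r.sign ∈ Set.Icc (-1 : ℝ) 1 := by
  rcases Real.sign_apply_eq r with h | h | h <;> rw [h] <;> norm_num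

/-- A minimizer over the box `[-1, 1]^ι` of the quadratic form at `c + (1 / 2) w ⊙ s` yields a
point `u` satisfying the complementarity relations of `uᵀ A⁻¹ u + 2 cᵀ u + ∑ wᵢ |uᵢ|`. -/
lemma Matrix.PosSemidef.exists_box_complementarity {A : Matrix ι ι ℝ} (hA : A.PosSemidef)
    (c w : ι → ℝ) (hw : ∀ i, 0 ≤ w i) :
    ∃ s u : ι → ℝ, (∀ i, s i ∈ Set.Icc (-1 : ℝ) 1) ∧
      u = -(A *ᵥ (c + (1 / 2 : ℝ) • (w * s))) ∧
      ∀ i, u i ≠ 0 → w i * (Real.sign (u i) - s i) = 0 := by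
  set K : Set (ι → ℝ) := Set.univ.pi fun _ => Set.Icc (-1 : ℝ) 1 with hK
  have hKc : IsCompact K := isCompact_univ_pi fun _ => isCompact_Icc
  have hKconv : Convex ℝ K := convex_pi fun _ _ => convex_Icc _ _
  let φ : (ι → ℝ) →ᵃ[ℝ] (ι → ℝ) :=
    AffineMap.const ℝ _ c + ((1 / 2 : ℝ) • LinearMap.mulLeft ℝ w).toAffineMap
  have hφ : ∀ s, φ s = c + (1 / 2 : ℝ) • (w * s) := fun s => rfl
  have hcont : Continuous φ := by
    simp only [funext hφ]
    fun_prop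
  obtain ⟨y, ⟨s, hs, rfl⟩, hmin⟩ := (hKc.image hcont).exists_isMinOn
    (f := fun v : ι → ℝ => v ⬝ᵥ A *ᵥ v)
    (Set.Nonempty.image _ ⟨0, fun i _ => by simp⟩)
    (Continuous.continuousOn (continuous_id.dotProduct (continuous_const.matrix_mulVec continuous_id)))
  refine ⟨s, -(A *ᵥ φ s), fun i => hs i trivial, by rw [hφ], ?_⟩
  set u := -(A *ᵥ φ s) with hu
  have hsgn : (fun i => Real.sign (u i)) ∈ K := fun i _ => Real.sign_mem_Icc _
  have hopt := hA.nonneg_of_isMinOn (hKconv.affine_image φ) ⟨s, hs, rfl⟩ ⟨_, hsgn, rfl⟩ hmin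
  have hAu : A *ᵥ φ s = -u := by rw [hu, neg_neg]
  have hsum : ∑ i, w i * (Real.sign (u i) - s i) * u i ≤ 0 := by
    rw [hAu, hφ, hφ, add_sub_add_left_eq_sub, ← smul_sub, smul_dotProduct, dotProduct_neg,
      smul_eq_mul, ← mul_sub] at hopt
    simp only [dotProduct, Pi.mul_apply, Pi.sub_apply] at hopt
    linarith
  have hnn : ∀ i ∈ Finset.univ, 0 ≤ w i * (Real.sign (u i) - s i) * u i := fun i _ => by
    obtain ⟨h1, h2⟩ := hs i trivial
    rw [mul_assoc]
    refine mul_nonneg (hw i) ?_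
    rcases lt_trichotomy (u i) 0 with h | h | h
    · rw [Real.sign_of_neg h]
      nlinarith
    · simp [h]
    · rw [Real.sign_of_pos h]
      nlinarith
  have hzero := (Finset.sum_eq_zero_iff_of_nonneg hnn).1
    (le_antisymm hsum (Finset.sum_nonneg hnn))
  exact fun i hi => (mul_eq_zero.1 (hzero i (Finset.mem_univ i))).resolve_right hi

/-- A quadratic form on the box `b + w ⊙ [-1, 1]^ι` is dominated by its value at a vertex. -/
lemma Matrix.PosSemidef.exists_vertex_ge {A : Matrix ι ι ℝ} (hA : A.PosSemidef)
    (b w s : ι → ℝ) (hs : ∀ i, s i ∈ Set.Icc (-1 : ℝ) 1) :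
    ∃ v : ι → ℝ, (∀ i, v i = -1 ∨ v i = 1) ∧
      (b + w * s) ⬝ᵥ A *ᵥ (b + w * s) ≤ (b + w * v) ⬝ᵥ A *ᵥ (b + w * v) := by
  let φ : (ι → ℝ) →ᵃ[ℝ] (ι → ℝ) :=
    AffineMap.const ℝ _ b + (LinearMap.mulLeft ℝ w).toAffineMap
  have hconv := hA.convexOn_dotProduct_mulVec_self.comp_affineMap φ
  have hmem : s ∈ convexHull ℝ (Set.univ.pi fun _ : ι => ({-1, 1} : Set ℝ)) := by
    rw [convexHull_pi]
    intro i _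
    rw [convexHull_pair, segment_eq_Icc (by norm_num)]
    exact hs i
  obtain ⟨v, hv, hle⟩ := hconv.exists_ge_of_mem_convexHull (Set.subset_univ _) hmem
  exact ⟨v, fun i => hv i trivial, hle⟩

/-- Upper bound on the centred form by the values at the vertices of the box `b + w ⊙ [-1, 1]^ι`. -/
lemma Matrix.PosSemidef.centred_le_of_vertex_le {A : Matrix ι ι ℝ} (hA : A.PosSemidef)
    (b w s : ι → ℝ) (hs : ∀ i, s i ∈ Set.Icc (-1 : ℝ) 1) {M : ℝ}
    (hM : ∀ v : ι → ℝ, (∀ i, v i = -1 ∨ v i = 1) →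
      (b + w * v) ⬝ᵥ A *ᵥ (b + w * v) ≤ M) :
    (w * s) ⬝ᵥ A *ᵥ (w * s) ≤ M := by
  obtain ⟨v, hv, hle⟩ := hA.exists_vertex_ge b w s hs
  obtain ⟨v', hv', hle'⟩ := hA.exists_vertex_ge b w (-s) fun i => by
    obtain ⟨h1, h2⟩ := hs i
    constructor <;> simp only [Pi.neg_apply] <;> linarith
  have h := hle.trans (hM v hv)
  have h' := hle'.trans (hM v' hv')
  rw [dotProduct_mulVec_add_self hA.isSymm_real] at h h'
  simp only [mul_neg, neg_dotProduct, mulVec_neg, dotProduct_neg, neg_neg] at h'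
  linarith [hA.dotProduct_mulVec_self_nonneg b]

end Box

/-- The per-stage cost
`ρ(u) = (u − u⁰(u))ᵀΛ(u − u⁰(u)) − (α/4)(Bᵀμ + w⊙S(u))ᵀΛ⁻¹(Bᵀμ + w⊙S(u))`, with
`u⁰(u) = −Λ⁻¹(Σx + ½(Bᵀμ + w⊙S(u)))`, has a finite infimum: with
`M = max_{s ∈ {−1,0,1}ᵐ} (Bᵀμ + w⊙s)ᵀΛ⁻¹(Bᵀμ + w⊙s)` one has
`−(α/4)·M ≤ inf ρ ≤ (1/4)·M`. -/
theorem stmt16 (n m : ℕ) (α : ℝ) (hα : 0 < α)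
    (Λ : Matrix (Fin m) (Fin m) ℝ) (hΛ : Λ.PosDef)
    (B : Matrix (Fin n) (Fin m) ℝ) (Sg : Matrix (Fin m) (Fin n) ℝ)
    (μv x : Fin n → ℝ) (w : Fin m → ℝ) (hw : ∀ i, 0 ≤ w i) :
    let q : (Fin m → ℝ) → Fin m → ℝ :=
      fun s => Bᵀ *ᵥ μv + fun i => w i * s i
    let u0 : (Fin m → ℝ) → Fin m → ℝ :=
      fun u => -(Λ⁻¹ *ᵥ (Sg *ᵥ x + (1 / 2 : ℝ) • q (fun i => Real.sign (u i))))
    let ρ : (Fin m → ℝ) → ℝ := fun u =>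
      (u - u0 u) ⬝ᵥ Λ *ᵥ (u - u0 u) -
        (α / 4) * (q (fun i => Real.sign (u i)) ⬝ᵥ Λ⁻¹ *ᵥ q (fun i => Real.sign (u i)))
    let M : ℝ := sSup {v : ℝ | ∃ s : Fin m → ℝ,
      (∀ i, s i = -1 ∨ s i = 0 ∨ s i = 1) ∧ v = q s ⬝ᵥ Λ⁻¹ *ᵥ q s}
    BddBelow (Set.range ρ) ∧ -(α / 4) * M ≤ sInf (Set.range ρ) ∧
      sInf (Set.range ρ) ≤ (1 / 4) * M := by
  intro q u0 ρ M
  have hA : (Λ⁻¹).PosSemidef := hΛ.inv.posSemidef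
  have hdet : IsUnit Λ.det := (Matrix.isUnit_iff_isUnit_det _).1 hΛ.isUnit
  have hbdd : BddAbove {v : ℝ | ∃ s : Fin m → ℝ,
      (∀ i, s i = -1 ∨ s i = 0 ∨ s i = 1) ∧ v = q s ⬝ᵥ Λ⁻¹ *ᵥ q s} := by
    have hfin : {s : Fin m → ℝ | ∀ i, s i ∈ ({-1, 0, 1} : Set ℝ)}.Finite :=
      Set.Finite.pi' fun _ => Set.toFinite _
    refine ((hfin.image fun s => q s ⬝ᵥ Λ⁻¹ *ᵥ q s).subset ?_).bddAbove
    rintro v ⟨s, hs, rfl⟩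
    exact ⟨s, hs, rfl⟩
  have hle : ∀ s : Fin m → ℝ, (∀ i, s i = -1 ∨ s i = 0 ∨ s i = 1) →
      q s ⬝ᵥ Λ⁻¹ *ᵥ q s ≤ M := fun s hs => le_csSup hbdd ⟨s, hs, rfl⟩
  have hlow : ∀ r ∈ Set.range ρ, -(α / 4) * M ≤ r := by
    rintro _ ⟨u, rfl⟩
    have h1 := hle (fun i => Real.sign (u i)) fun i => Real.sign_apply_eq _
    have h2 := hΛ.posSemidef.dotProduct_mulVec_self_nonneg (u - u0 u)
    have h3 := mul_le_mul_of_nonneg_left h1 (by positivity : 0 ≤ α / 4)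
    simp only [ρ]
    linarith
  have hbelow : BddBelow (Set.range ρ) := ⟨_, hlow⟩
  refine ⟨hbelow, le_csInf (Set.range_nonempty ρ) hlow, ?_⟩
  obtain ⟨s, u, hs, hu, hcomp⟩ := hA.exists_box_complementarity
    (Sg *ᵥ x + (1 / 2 : ℝ) • (Bᵀ *ᵥ μv)) w hw
  refine (csInf_le hbelow ⟨u, rfl⟩).trans ?_
  let d : Fin m → ℝ := fun i => Real.sign (u i) - s i
  let e : Fin m → ℝ := fun i => if u i = 0 then d i else 0
  have hde : w * d = w * e := by
    funext i
    by_cases h : u i = 0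
    · simp [e, h]
    · simpa [e, h] using hcomp i h
  have he : ∀ i, e i ∈ Set.Icc (-1 : ℝ) 1 := fun i => by
    obtain ⟨h1, h2⟩ := hs i
    by_cases h : u i = 0
    · simp only [e, d, h, if_true, Real.sign_zero]
      constructor <;> linarith
    · simp [e, h]
  have hdiff : u - u0 u = (1 / 2 : ℝ) • (Λ⁻¹ *ᵥ (w * e)) := by
    have hq : q (fun i => Real.sign (u i)) = Bᵀ *ᵥ μv + w * s + w * e := by
      rw [← hde]
      funext i
      simp only [q, d, Pi.add_apply, Pi.mul_apply]
      ring
    simp only [u0]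
    rw [hq]
    conv_lhs => rw [hu]
    simp only [mulVec_add, mulVec_smul, smul_add]
    abel
  have hquad : (u - u0 u) ⬝ᵥ Λ *ᵥ (u - u0 u) = 1 / 4 * ((w * e) ⬝ᵥ Λ⁻¹ *ᵥ (w * e)) := by
    rw [hdiff, dotProduct_mulVec_smul_self, mulVec_mulVec, Matrix.mul_nonsing_inv _ hdet,
      one_mulVec, dotProduct_comm]
    norm_num
  have hM : (w * e) ⬝ᵥ Λ⁻¹ *ᵥ (w * e) ≤ M :=
    hA.centred_le_of_vertex_le (Bᵀ *ᵥ μv) w e he fun v hv =>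
      hle v fun i => (hv i).imp_right Or.inr
  have hnn := mul_nonneg (by positivity : 0 ≤ α / 4)
    (hA.dotProduct_mulVec_self_nonneg (q fun i => Real.sign (u i)))
  simp only [ρ]
  rw [hquad]
  linarith
end
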